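/- There exists a constant K > 0 such that for every ℓ ≥ 2 and every word k ∈ {0,1,2}^* with 1 ≤ |k| ≤ ℓ, the permutation add_k of C_ℓ (for the decorated SMART state set and alphabet) belongs to G_ℓ with word norm at most K·|k|³, where add_k fixes head-free configurations and maps each configuration with head at position i₀, state q, and tape letters a₀ a₁ ⋯ a_{ℓ−1} read from i₀ (a₀ being the head's own tape letter) to the configuration with the same head position and state and tape letters a₀' ⋯ a_{|k|−1}' a_{|k|} ⋯ a_{ℓ−1}, where v₃(a₀'⋯a_{|k|−1}') = (v₃(a₀⋯a_{|k|−1}) + v₃(k)) mod 3^{|k|}. -/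

import Mathlib

/-- The word norm of `g` with respect to the generating set `F`:
the least `n` such that `g` is a product of `n` elements of `F ∪ F⁻¹`. -/
noncomputable def wordNorm {G : Type*} [Group G] (F : Set G) (g : G) : ℕ :=
  sInf {n : ℕ | ∃ w : List G, w.length = n ∧ (∀ x ∈ w, x ∈ F ∨ x⁻¹ ∈ F) ∧ w.prod = g}
/-! ### Turing machine symbols and local step functions -/

/-- Tape/head symbols: a plain tape letter, or a head `(q, a)` on top of letter `a`. -/
abbrev TSym (Q Γ : Type) : Type := Γ ⊕ (Q × Γ)

/-- The tape letter carried by a cell (under the head if the cell carries the head). -/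
def tapeLetter {Q Γ : Type} : TSym Q Γ → Γ
  | Sum.inl a => a
  | Sum.inr (_, a) => a

/-- A complete deterministic machine is given by a head-step function: at `(q, a)` it either
rewrites the head in place (`.inl (q', b)`, a matching transition), or moves in direction
`δ ∈ {+1, -1}` into state `q'` (`.inr (δ, q')`, a move transition). -/
abbrev HeadStep (Q Γ : Type) : Type := Q → Γ → ((Q × Γ) ⊕ (ℤ × Q))

/-- If the symbol `s` carries a head about to move in direction `d`, the state in which the
head arrives; `none` otherwise. -/
def arrivesAs {Q Γ : Type} (δ : HeadStep Q Γ) (s : TSym Q Γ) (d : ℤ) : Option Q :=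
  match s with
  | Sum.inl _ => none
  | Sum.inr (q, a) =>
    match δ q a with
    | Sum.inl _ => none
    | Sum.inr (d', q') => if d' = d then some q' else none

/-- The local rule of the moving-head dynamics: the new symbol of a cell, given the symbols
`l, c, r` of its left neighbour, itself, and its right neighbour. -/
def localStep {Q Γ : Type} (δ : HeadStep Q Γ) (l c r : TSym Q Γ) : TSym Q Γ :=
  match c with
  | Sum.inr (q, a) =>
    (match δ q a with
     | Sum.inl qb => Sum.inr qb
     | Sum.inr _ => Sum.inl a)
  | Sum.inl a =>
    (match arrivesAs δ l 1 with
     | some q' => Sum.inr (q', a)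
     | none =>
       match arrivesAs δ r (-1) with
       | some q' => Sum.inr (q', a)
       | none => Sum.inl a)

/-- The moving-head action of a complete deterministic machine on bi-infinite tapes. -/
def stepZ {Q Γ : Type} (δ : HeadStep Q Γ) (x : ℤ → TSym Q Γ) : ℤ → TSym Q Γ :=
  fun i => localStep δ (x (i - 1)) (x i) (x (i + 1))

/-- The action of a complete deterministic machine on cyclic tapes of length `ℓ`. -/
def stepC {Q Γ : Type} (δ : HeadStep Q Γ) (ℓ : ℕ) (w : ZMod ℓ → TSym Q Γ) :
    ZMod ℓ → TSym Q Γ :=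
  fun i => localStep δ (w (i - 1)) (w i) (w (i + 1))

/-- A configuration has at most one head. -/
def AtMostOneHeadZ {Q Γ : Type} (x : ℤ → TSym Q Γ) : Prop :=
  ∀ i j : ℤ, (x i).isRight = true → (x j).isRight = true → i = j

/-- A cyclic configuration has at most one head. -/
def AtMostOneHeadC {Q Γ : Type} {ℓ : ℕ} (w : ZMod ℓ → TSym Q Γ) : Prop :=
  ∀ i j : ZMod ℓ, (w i).isRight = true → (w j).isRight = true → i = j

/-! ### The SMART machine -/

/-- The four arrows `▶, ◀, ▷, ◁` (filled right/left, hollow right/left). -/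
inductive Arrow : Type
  | rf  -- ▶ (filled right)
  | lf  -- ◀ (filled left)
  | rh  -- ▷ (hollow right)
  | lh  -- ◁ (hollow left)
deriving DecidableEq

/-- The SMART state set `Q̊`: an arrow with a subscript in `{1,2}`; the subscript `b`
is represented by the `Fin 2` value `b - 1`. -/
abbrev SQ : Type := Arrow × Fin 2

/-- The SMART tape alphabet `{0,1,2}`. -/
abbrev Letter : Type := Fin 3

/-- The head-step function of the SMART machine.  States `q₂` (second component `1`) are
move states; states `q₁` (second component `0`) are matching states. -/
def smartStep : HeadStep SQ Letter := fun q a =>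
  if q.2 = 1 then
    match q.1 with
    | .rf => Sum.inr (1, (.rf, 0))   -- (▶₂, +1, ▶₁)
    | .lf => Sum.inr (-1, (.lf, 0))  -- (◀₂, −1, ◀₁)
    | .rh => Sum.inr (1, (.rh, 0))   -- (▷₂, +1, ▷₁)
    | .lh => Sum.inr (-1, (.lh, 0))  -- (◁₂, −1, ◁₁)
  else
    match q.1 with
    | .rf => Sum.inl (if a = 0 then ((.lf, 1), 1) else if a = 1 then ((.lh, 1), 1) else ((.lh, 1), 2))
    | .lf => Sum.inl (if a = 0 then ((.rf, 1), 1) else if a = 1 then ((.rh, 1), 1) else ((.rh, 1), 2))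
    | .rh => Sum.inl (if a = 0 then ((.rf, 1), 2) else if a = 1 then ((.rf, 1), 0) else ((.lh, 1), 0))
    | .lh => Sum.inl (if a = 0 then ((.lf, 1), 2) else if a = 1 then ((.lf, 1), 0) else ((.rh, 1), 0))

/-! ### The decorated SMART machine -/

/-- The state set of the decorated SMART machine: a SMART state together with a *duck*
`d ∈ {d₀, d₁}` (as `Fin 2`, `0 ↦ d₀`) and a *ghost* `x ∈ {0,…,5}` (as `Fin 6`). -/
abbrev DQ : Type := SQ × Fin 2 × Fin 6

/-- The head-step function of the decorated SMART machine: it acts as SMART on the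
`Q̊`-component and carries the duck and ghost unchanged. -/
def decStep : HeadStep DQ Letter := fun q a =>
  match smartStep q.1 a with
  | Sum.inl (q', b) => Sum.inl ((q', q.2), b)
  | Sum.inr (d, q') => Sum.inr (d, (q', q.2))

/-! ### The group `G_ℓ` of Turing machine instructions on cyclic tapes -/

/-- Cyclic configurations of length `ℓ` with at most one head. -/
abbrev CConf (Q Γ : Type) (ℓ : ℕ) : Type :=
  {w : ZMod ℓ → TSym Q Γ // AtMostOneHeadC w}

/-- The pointwise action on symbols of a permutation `g` of head symbols. -/
def gateApply {Q Γ : Type} (g : Equiv.Perm (Q × Γ)) : TSym Q Γ → TSym Q Γ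
  | Sum.inl a => Sum.inl a
  | Sum.inr h => Sum.inr (g h)

/-- `π` is the unary gate `π_g`: it applies `g` to the head symbol (if a head is present)
and fixes all other cells. -/
def IsUnaryGate {Q Γ : Type} {ℓ : ℕ} (g : Equiv.Perm (Q × Γ))
    (π : Equiv.Perm (CConf Q Γ ℓ)) : Prop :=
  ∀ w : CConf Q Γ ℓ, ∀ i : ZMod ℓ, (π w).1 i = gateApply g (w.1 i)

/-- `π` is the state-dependent right move `ρ_q`: it moves a head in state `q` one position
to the right (mod `ℓ`), leaving its tape letter behind and picking up the next cell's
letter, and fixes configurations whose head is not in state `q`. -/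
def IsMoveGate {Q Γ : Type} [DecidableEq Q] {ℓ : ℕ} (q : Q)
    (π : Equiv.Perm (CConf Q Γ ℓ)) : Prop :=
  ∀ w : CConf Q Γ ℓ,
    ((∀ i a, w.1 i ≠ Sum.inr (q, a)) → π w = w) ∧
    (∀ i a, w.1 i = Sum.inr (q, a) →
      ∀ j : ZMod ℓ, (π w).1 j =
        if j = i + 1 then Sum.inr (q, tapeLetter (w.1 (i + 1)))
        else if j = i then Sum.inl a
        else w.1 j)

/-- The generating set of the group `G_ℓ` of Turing machine instructions: all unary gates
`π_g` and all state-dependent moves `ρ_q`. -/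
def TMGens (Q Γ : Type) [DecidableEq Q] (ℓ : ℕ) : Set (Equiv.Perm (CConf Q Γ ℓ)) :=
  {π | (∃ g, IsUnaryGate g π) ∨ (∃ q, IsMoveGate q π)}

/-- The base-3 value `v₃` of the word formed by the first `L` values of `u`
(most significant digit first). -/
def wordVal3 (L : ℕ) (u : ℕ → Letter) : ℕ :=
  ∑ t ∈ Finset.range L, 3 ^ (L - 1 - t) * (u t).val

/-- The `(t+1)`-st base-3 digit (most significant first) of `m` written with `L` digits. -/
def digit3L (L m t : ℕ) : Letter :=
  ⟨m / 3 ^ (L - 1 - t) % 3, Nat.mod_lt _ (by norm_num)⟩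

/-- The word of tape letters of `w` read rightwards from position `i₀`. -/
def readWord (ℓ : ℕ) (w : ZMod ℓ → TSym DQ Letter) (i₀ : ZMod ℓ) : ℕ → Letter :=
  fun t => tapeLetter (w (i₀ + (t : ZMod ℓ)))

namespace TernaryAdd

open Equiv
open scoped commutatorElement

/-! ### Products of boundedly many generators -/

/-- `g` is a product of at most `n` elements of `F ∪ F⁻¹`. -/
def HasLength {G : Type*} [Group G] (F : Set G) (n : ℕ) (g : G) : Prop :=
  ∃ w : List G, w.length ≤ n ∧ (∀ x ∈ w, x ∈ F ∨ x⁻¹ ∈ F) ∧ w.prod = g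

namespace HasLength

variable {G : Type*} [Group G] {F : Set G} {m n : ℕ} {g h : G}

lemma one : HasLength F n 1 := ⟨[], by simp⟩

lemma of_mem (hg : g ∈ F) : HasLength F 1 g := ⟨[g], by simp [hg]⟩

lemma mono (hg : HasLength F m g) (hmn : m ≤ n) : HasLength F n g := by
  obtain ⟨w, hw, hF, hp⟩ := hg
  exact ⟨w, hw.trans hmn, hF, hp⟩

lemma mul (hg : HasLength F m g) (hh : HasLength F n h) : HasLength F (m + n) (g * h) := by
  obtain ⟨w, hw, hF, rfl⟩ := hg
  obtain ⟨v, hv, hF', rfl⟩ := hh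
  refine ⟨w ++ v, by simp only [List.length_append]; omega, fun x hx => ?_, by simp⟩
  rcases List.mem_append.1 hx with hx | hx
  exacts [hF x hx, hF' x hx]

lemma inv (hg : HasLength F n g) : HasLength F n g⁻¹ := by
  obtain ⟨w, hw, hF, rfl⟩ := hg
  refine ⟨(w.map (·⁻¹)).reverse, by simpa using hw, fun x hx => ?_,
    (List.prod_inv_reverse w).symm⟩
  obtain ⟨y, hy, rfl⟩ : ∃ y ∈ w, y⁻¹ = x := by simpa using hx
  simpa using (hF y hy).symm

lemma conj (hh : HasLength F m h) (hg : HasLength F n g) :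
    HasLength F (2 * m + n) (h * g * h⁻¹) :=
  ((hh.mul hg).mul hh.inv).mono (by omega)

lemma pow (hg : HasLength F n g) : ∀ k : ℕ, HasLength F (k * n) (g ^ k)
  | 0 => by simpa using one
  | k + 1 => by
    rw [pow_succ]
    exact ((pow hg k).mul hg).mono (by rw [Nat.succ_mul])

lemma map {H : Type*} [Group H] {F' : Set H} (φ : G →* H) (hφ : ∀ x ∈ F, φ x ∈ F')
    (hg : HasLength F n g) : HasLength F' n (φ g) := by
  obtain ⟨w, hw, hF, rfl⟩ := hg
  refine ⟨w.map φ, by simpa using hw, fun x hx => ?_, (map_list_prod φ w).symm⟩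
  obtain ⟨y, hy, rfl⟩ := List.mem_map.1 hx
  exact (hF y hy).imp (hφ y) fun h => by simpa using hφ _ h

lemma wordNorm_le (hg : HasLength F n g) : wordNorm F g ≤ n := by
  obtain ⟨w, hw, hF, hp⟩ := hg
  have : w.length ∈ {n : ℕ | ∃ w : List G, w.length = n ∧
      (∀ x ∈ w, x ∈ F ∨ x⁻¹ ∈ F) ∧ w.prod = g} := ⟨w, rfl, hF, hp⟩
  exact (Nat.sInf_le this).trans hw

lemma mem_closure (hg : HasLength F n g) : g ∈ Subgroup.closure F := by
  obtain ⟨w, -, hF, rfl⟩ := hg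
  refine Subgroup.list_prod_mem _ fun x hx => ?_
  rcases hF x hx with h | h
  · exact Subgroup.subset_closure h
  · simpa using inv_mem (Subgroup.subset_closure h)

end HasLength

/-! ### Configurations with a head in absolute coordinates -/

/-- A configuration with a head: head position, tape contents, and state. -/
abbrev HConf (ℓ : ℕ) : Type := (ZMod ℓ × (ZMod ℓ → Letter)) × DQ

variable {ℓ : ℕ}

/-- The unary gate of `g` on configurations with a head. -/
def headGate (g : Perm (DQ × Letter)) : Perm (HConf ℓ) where
  toFun x := ((x.1.1, Function.update x.1.2 x.1.1 (g (x.2, x.1.2 x.1.1)).2),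
    (g (x.2, x.1.2 x.1.1)).1)
  invFun x := ((x.1.1, Function.update x.1.2 x.1.1 (g.symm (x.2, x.1.2 x.1.1)).2),
    (g.symm (x.2, x.1.2 x.1.1)).1)
  left_inv x := by simp
  right_inv x := by simp

/-- The move of a head in state `q` on configurations with a head. -/
def stateMove (q : DQ) : Perm (HConf ℓ) where
  toFun x := if x.2 = q then ((x.1.1 + 1, x.1.2), x.2) else x
  invFun x := if x.2 = q then ((x.1.1 - 1, x.1.2), x.2) else x
  left_inv x := by
    obtain ⟨y, r⟩ := x
    by_cases h : r = q <;> simp [h]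
  right_inv x := by
    obtain ⟨y, r⟩ := x
    by_cases h : r = q <;> simp [h]

/-- The generators acting on configurations with a head. -/
def gens (ℓ : ℕ) : Set (Perm (HConf ℓ)) :=
  {π | (∃ g, headGate g = π) ∨ ∃ q, stateMove q = π}

lemma hasLength_headGate (g : Perm (DQ × Letter)) :
    HasLength (gens ℓ) 1 (headGate g) := .of_mem (.inl ⟨g, rfl⟩)

/-- The state-independent move of the head by `s` cells. -/
def shift (s : ZMod ℓ) : Perm (HConf ℓ) where
  toFun x := ((x.1.1 + s, x.1.2), x.2)
  invFun x := ((x.1.1 - s, x.1.2), x.2)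
  left_inv x := by simp
  right_inv x := by simp

lemma shift_natCast (n : ℕ) : shift (n : ZMod ℓ) = shift 1 ^ n := by
  induction n with
  | zero => ext1 x; simp [shift]
  | succ n ih =>
    rw [pow_succ', ← ih]
    ext1 x
    simp [shift, add_assoc]

instance : Fintype Arrow := ⟨{.rf, .lf, .rh, .lh}, fun a => by cases a <;> simp⟩

lemma card_states : Fintype.card DQ = 96 := by
  simp only [Fintype.card_prod, Fintype.card_fin]
  rfl

lemma prod_stateMove_apply (l : List DQ) (hl : l.Nodup) (x : HConf ℓ) :
    (l.map stateMove).prod x = if x.2 ∈ l then shift 1 x else x := by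
  induction l with
  | nil => simp
  | cons q l ih =>
    obtain ⟨hq, hl⟩ := List.nodup_cons.1 hl
    rw [List.map_cons, List.prod_cons, Perm.mul_apply, ih hl]
    by_cases hx : x.2 = q
    · have : x.2 ∉ l := hx ▸ hq
      simp [hx, hq, stateMove, shift]
    · by_cases h : x.2 ∈ l <;> simp [hx, h, stateMove, shift]

lemma hasLength_shift (n : ℕ) : HasLength (gens ℓ) (96 * n) (shift (n : ZMod ℓ)) := by
  have h1 : HasLength (gens ℓ) 96 (shift 1) := by
    refine ⟨(Finset.univ : Finset DQ).toList.map stateMove, ?_, ?_, ?_⟩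
    · simp only [List.length_map, Finset.length_toList, Finset.card_univ, card_states, le_refl]
    · simp only [List.mem_map]
      rintro _ ⟨q, -, rfl⟩
      exact .inl (.inr ⟨q, rfl⟩)
    · ext1 x
      rw [prod_stateMove_apply _ (Finset.nodup_toList _)]
      simp
  rw [shift_natCast, mul_comm]
  exact h1.pow n

/-! ### State permutations controlled by the tape -/

/-- Apply to the state a permutation depending on the head position and the tape. -/
def controlled : (ZMod ℓ × (ZMod ℓ → Letter) → Perm DQ) →* Perm (HConf ℓ) where
  toFun f := prodCongrRight f
  map_one' := rfl
  map_mul' _ _ := rfl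

@[simp] lemma controlled_apply (f : ZMod ℓ × (ZMod ℓ → Letter) → Perm DQ) (x : HConf ℓ) :
    controlled f x = (x.1, f x.1 x.2) := rfl

/-- A permutation of the ghosts, acting on states. -/
def ghost : Perm (Fin 6) →* Perm DQ where
  toFun s := prodCongrRight fun _ => prodCongrRight fun _ => s
  map_one' := rfl
  map_mul' _ _ := rfl

@[simp] lemma ghost_apply (s : Perm (Fin 6)) (q : DQ) : ghost s q = (q.1, q.2.1, s q.2.2) := rfl

open Classical in
/-- Apply `σ` to the state if the head position and the tape satisfy `P`. -/
noncomputable def ctrl (P : ZMod ℓ × (ZMod ℓ → Letter) → Prop) (σ : Perm DQ) : Perm (HConf ℓ) :=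
  controlled fun y => if P y then σ else 1

lemma ctrl_mul (P : ZMod ℓ × (ZMod ℓ → Letter) → Prop) (σ τ : Perm DQ) :
    ctrl P (σ * τ) = ctrl P σ * ctrl P τ := by
  rw [ctrl, ctrl, ctrl, ← map_mul]
  congr 1
  ext1 y
  by_cases h : P y <;> simp [h]

lemma ctrl_and_commutator (P R : ZMod ℓ × (ZMod ℓ → Letter) → Prop) (σ τ : Perm DQ) :
    ctrl (fun y => P y ∧ R y) ⁅σ, τ⁆ = ⁅ctrl P σ, ctrl R τ⁆ := by
  rw [ctrl, ctrl, ctrl, ← map_commutatorElement]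
  congr 1
  ext1 y
  by_cases h : P y <;> by_cases h' : R y <;> simp [h, h', commutatorElement_def]

lemma ctrl_or_of_disjoint (P R : ZMod ℓ × (ZMod ℓ → Letter) → Prop) (σ : Perm DQ)
    (h : ∀ y, P y → ¬ R y) : ctrl (fun y => P y ∨ R y) σ = ctrl P σ * ctrl R σ := by
  rw [ctrl, ctrl, ctrl, ← map_mul]
  congr 1
  ext1 y
  have := h y
  by_cases h : P y <;> by_cases h' : R y <;> simp_all

lemma ctrl_shift (P : ZMod ℓ × (ZMod ℓ → Letter) → Prop) (σ : Perm DQ) (s : ZMod ℓ) :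
    ctrl (fun y => P (y.1 + s, y.2)) σ = (shift s)⁻¹ * ctrl P σ * ((shift s)⁻¹)⁻¹ := by
  rw [inv_inv, mul_assoc, eq_inv_mul_iff_mul_eq]
  ext1 x
  simp [ctrl, shift]

/-- Every three-cycle of ghosts is a commutator of three-cycles. -/
lemma exists_commutator_of_isThreeCycle (s : Perm (Fin 6)) (hs : s.IsThreeCycle) :
    ∃ a b : Perm (Fin 6), a.IsThreeCycle ∧ b.IsThreeCycle ∧ ⁅a, b⁆ = s := by
  let a : Perm (Fin 6) := swap 0 1 * swap 0 2
  let b : Perm (Fin 6) := swap 0 3 * swap 0 4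
  have ha : a.IsThreeCycle :=
    Perm.isThreeCycle_swap_mul_swap_same (by decide) (by decide) (by decide)
  have hb : b.IsThreeCycle :=
    Perm.isThreeCycle_swap_mul_swap_same (by decide) (by decide) (by decide)
  have hab : ∃ i j k : Fin 6, i ≠ j ∧ i ≠ k ∧ j ≠ k ∧ ⁅a, b⁆ = swap i j * swap i k := by decide
  obtain ⟨i, j, k, hij, hik, hjk, h⟩ := hab
  have hc : (⁅a, b⁆).IsThreeCycle := h ▸ Perm.isThreeCycle_swap_mul_swap_same hij hik hjk
  obtain ⟨t, ht⟩ := isConj_iff.1 (Perm.isConj_iff_cycleType_eq.2 (hc.trans hs.symm))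
  refine ⟨t * a * t⁻¹, t * b * t⁻¹, ?_, ?_, ?_⟩
  · rw [Perm.IsThreeCycle, Perm.cycleType_conj, ha]
  · rw [Perm.IsThreeCycle, Perm.cycleType_conj, hb]
  · rw [← ht, commutatorElement_def, commutatorElement_def]
    group

/-- Three-cycles of ghosts controlled by `P` are products of at most `n` generators. -/
def Controllable (n : ℕ) (P : ZMod ℓ × (ZMod ℓ → Letter) → Prop) : Prop :=
  ∀ s : Perm (Fin 6), s.IsThreeCycle → HasLength (gens ℓ) n (ctrl P (ghost s))

namespace Controllable

variable {m n : ℕ} {P R : ZMod ℓ × (ZMod ℓ → Letter) → Prop}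

lemma mono (hP : Controllable m P) (hmn : m ≤ n) : Controllable n P :=
  fun s hs => (hP s hs).mono hmn

lemma and (hP : Controllable m P) (hR : Controllable n R) :
    Controllable (2 * m + 2 * n) (fun y => P y ∧ R y) := by
  intro s hs
  obtain ⟨a, b, ha, hb, rfl⟩ := exists_commutator_of_isThreeCycle s hs
  rw [map_commutatorElement, ctrl_and_commutator, commutatorElement_def]
  exact ((((hP a ha).mul (hR b hb)).mul (hP a ha).inv).mul (hR b hb).inv).mono (by omega)

lemma or (hP : Controllable m P) (hR : Controllable n R) (h : ∀ y, P y → ¬ R y) :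
    Controllable (m + n) (fun y => P y ∨ R y) := by
  intro s hs
  rw [ctrl_or_of_disjoint _ _ _ h]
  exact (hP s hs).mul (hR s hs)

lemma shift (hP : Controllable n P) (k : ℕ) :
    Controllable (192 * k + n) (fun y => P (y.1 + (k : ZMod ℓ), y.2)) := by
  intro s hs
  rw [ctrl_shift P (ghost s) (k : ZMod ℓ)]
  exact ((hasLength_shift k).inv.conj (hP s hs)).mono (by omega)

lemma false : Controllable (ℓ := ℓ) 0 (fun _ => False) := by
  intro s hs
  have : ctrl (ℓ := ℓ) (fun _ => False) (ghost s) = 1 := by ext1 x; simp [ctrl]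
  rw [this]
  exact .one

open Classical in
lemma head (p : Letter → Prop) : Controllable (ℓ := ℓ) 1 (fun y => p (y.2 y.1)) := by
  intro s hs
  have : ctrl (fun y : ZMod ℓ × (ZMod ℓ → Letter) => p (y.2 y.1)) (ghost s) =
      headGate ((prodComm _ _).trans ((prodCongrRight fun a => if p a then ghost s else 1).trans
        (prodComm _ _))) := by
    ext1 x
    simp [ctrl, headGate]
  rw [this]
  exact hasLength_headGate _

end Controllable

/-! ### Carries -/

/-- The tape word to the right of the head, the head cell included. -/
def word (y : ZMod ℓ × (ZMod ℓ → Letter)) : ℕ → Letter := fun t => y.2 (y.1 + (t : ZMod ℓ))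

lemma wordVal3_add (a b : ℕ) (u : ℕ → Letter) :
    wordVal3 (a + b) u = 3 ^ b * wordVal3 a u + wordVal3 b fun t => u (a + t) := by
  rw [wordVal3, wordVal3, wordVal3, Finset.sum_range_add, Finset.mul_sum]
  congr 1 <;> refine Finset.sum_congr rfl fun t ht => ?_
  · have := Finset.mem_range.1 ht
    rw [← mul_assoc, ← pow_add]
    congr 3
    omega
  · rw [show a + b - 1 - (a + t) = b - 1 - t by omega]

lemma wordVal3_one (u : ℕ → Letter) : wordVal3 1 u = (u 0).val := by simp [wordVal3]

lemma wordVal3_lt (n : ℕ) (u : ℕ → Letter) : wordVal3 n u < 3 ^ n := by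
  induction n with
  | zero => simp [wordVal3]
  | succ n ih =>
    rw [wordVal3_add, wordVal3_one, pow_succ]
    have := (u (n + 0)).isLt
    omega

/-- Adding the first `n` letters of `k` to the first `n` letters of the tape overflows. -/
def Carry (n : ℕ) (k : ℕ → Letter) (y : ZMod ℓ × (ZMod ℓ → Letter)) : Prop :=
  3 ^ n ≤ wordVal3 n (word y) + wordVal3 n k

/-- Adding the first `n` letters of `k` to the first `n` letters of the tape propagates a carry. -/
def Propagate (n : ℕ) (k : ℕ → Letter) (y : ZMod ℓ × (ZMod ℓ → Letter)) : Prop :=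
  wordVal3 n (word y) + wordVal3 n k + 1 = 3 ^ n

lemma word_shift (a : ℕ) (y : ZMod ℓ × (ZMod ℓ → Letter)) :
    (fun t => word y (a + t)) = word (y.1 + (a : ZMod ℓ), y.2) := by
  ext1 t
  simp [word, add_assoc]

lemma propagate_add (a b : ℕ) (k : ℕ → Letter) (y : ZMod ℓ × (ZMod ℓ → Letter)) :
    Propagate (a + b) k y ↔
      Propagate a k y ∧ Propagate b (fun t => k (a + t)) (y.1 + (a : ZMod ℓ), y.2) := by
  simp only [Propagate, wordVal3_add, word_shift, pow_add]
  have h1 := wordVal3_lt b (word (y.1 + (a : ZMod ℓ), y.2))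
  have h2 := wordVal3_lt b fun t => k (a + t)
  generalize wordVal3 a (word y) = A at *
  generalize wordVal3 a k = B at *
  generalize wordVal3 b (word (y.1 + (a : ZMod ℓ), y.2)) = C at *
  generalize (wordVal3 b fun t => k (a + t)) = D at *
  generalize 3 ^ a = M at *
  generalize 3 ^ b = N at *
  constructor
  · intro h
    have hM : A + B + 1 = M := by
      rcases lt_trichotomy (A + B + 1) M with hlt | heq | hgt
      · nlinarith
      · exact heq
      · nlinarith
    refine ⟨hM, ?_⟩
    subst hM
    nlinarith
  · rintro ⟨rfl, h⟩
    nlinarith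

lemma carry_add (a b : ℕ) (k : ℕ → Letter) (y : ZMod ℓ × (ZMod ℓ → Letter)) :
    Carry (a + b) k y ↔ Carry a k y ∨
      (Propagate a k y ∧ Carry b (fun t => k (a + t)) (y.1 + (a : ZMod ℓ), y.2)) := by
  simp only [Propagate, Carry, wordVal3_add, word_shift, pow_add]
  have h1 := wordVal3_lt b (word (y.1 + (a : ZMod ℓ), y.2))
  have h2 := wordVal3_lt b fun t => k (a + t)
  generalize wordVal3 a (word y) = A at *
  generalize wordVal3 a k = B at *
  generalize wordVal3 b (word (y.1 + (a : ZMod ℓ), y.2)) = C at *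
  generalize (wordVal3 b fun t => k (a + t)) = D at *
  generalize 3 ^ a = M at *
  generalize 3 ^ b = N at *
  constructor
  · intro h
    by_contra! hc
    rcases lt_or_eq_of_le (Nat.succ_le_of_lt hc.1) with hlt | heq
    · nlinarith
    · have := hc.2 heq
      subst heq
      nlinarith
  · rintro (h | ⟨rfl, h⟩)
    · nlinarith
    · nlinarith

lemma controllable_propagate (n : ℕ) (hn : 1 ≤ n) (k : ℕ → Letter) :
    ∃ c, c + 399 * n ≤ 400 * n ^ 2 ∧ Controllable (ℓ := ℓ) c (Propagate n k) := by
  induction n using Nat.strong_induction_on generalizing k with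
  | _ n ih =>
    rcases hn.eq_or_lt with rfl | hn
    · refine ⟨1, by norm_num, ?_⟩
      have := Controllable.head (ℓ := ℓ) fun a => a.val + (k 0).val + 1 = 3
      have heq : Propagate (ℓ := ℓ) 1 k = fun y => (y.2 y.1).val + (k 0).val + 1 = 3 := by
        ext1 y
        simp [Propagate, wordVal3_one, word]
      rwa [heq]
    · obtain ⟨a, b, hb, hab, hba, rfl⟩ : ∃ a b, 1 ≤ b ∧ b ≤ a ∧ a ≤ b + 1 ∧ n = a + b :=
        ⟨n - n / 2, n / 2, by omega, by omega, by omega, by omega⟩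
      obtain ⟨c, hc, hP⟩ := ih a (by omega) (by omega) k
      obtain ⟨d, hd, hR⟩ := ih b (by omega) hb fun t => k (a + t)
      refine ⟨2 * c + 2 * (192 * a + d), ?_, ?_⟩
      · obtain rfl | rfl : a = b ∨ a = b + 1 := by omega
        · nlinarith
        · nlinarith
      · rw [show Propagate (ℓ := ℓ) (a + b) k = _ from
          funext fun y => propext (propagate_add a b k y)]
        exact hP.and (hR.shift a)

lemma controllable_carry (n : ℕ) (k : ℕ → Letter) :
    Controllable (ℓ := ℓ) (2368 * n ^ 2) (Carry n k) := by
  induction n using Nat.strong_induction_on generalizing k with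
  | _ n ih =>
    rcases (by omega : n = 0 ∨ n = 1 ∨ 2 ≤ n) with rfl | rfl | hn
    · have : Carry (ℓ := ℓ) 0 k = fun _ => False := by
        ext1 y
        simp [Carry, wordVal3]
      rw [this]
      exact Controllable.false
    · have := Controllable.head (ℓ := ℓ) fun a => 3 ≤ a.val + (k 0).val
      refine Controllable.mono (m := 1) ?_ (by norm_num)
      have heq : Carry (ℓ := ℓ) 1 k = fun y => 3 ≤ (y.2 y.1).val + (k 0).val := by
        ext1 y
        simp [Carry, wordVal3_one, word]
      rwa [heq]
    · obtain ⟨a, b, hb, hab, hba, rfl⟩ : ∃ a b, 1 ≤ b ∧ b ≤ a ∧ a ≤ b + 1 ∧ n = a + b :=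
        ⟨n - n / 2, n / 2, by omega, by omega, by omega, by omega⟩
      obtain ⟨c, hc, hP⟩ := controllable_propagate (ℓ := ℓ) a (by omega) k
      have hC := ih a (by omega) k
      have hR := ih b (by omega) fun t => k (a + t)
      rw [show Carry (ℓ := ℓ) (a + b) k = _ from funext fun y => propext (carry_add a b k y)]
      refine (hC.or (hP.and (hR.shift a)) ?_).mono ?_
      · rintro y h ⟨h', -⟩
        simp only [Carry, Propagate] at h h'
        omega
      · obtain rfl | rfl : a = b ∨ a = b + 1 := by omega
        · nlinarith
        · nlinarith

/-! ### Controlled addition on the head cell and the addition gate -/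

/-- A ghost as a pair of a bit and a residue modulo `3`. -/
def splitGhost : Fin 6 ≃ Fin 2 × Letter := (finProdFinEquiv (m := 2) (n := 3)).symm

/-- Exchange the tape letter under the head with the residue of the ghost modulo `3`. -/
def exchange : Perm (DQ × Letter) where
  toFun x := ((x.1.1, x.1.2.1, splitGhost.symm ((splitGhost x.1.2.2).1, x.2)),
    (splitGhost x.1.2.2).2)
  invFun x := ((x.1.1, x.1.2.1, splitGhost.symm ((splitGhost x.1.2.2).1, x.2)),
    (splitGhost x.1.2.2).2)
  left_inv x := by simp
  right_inv x := by simp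

/-- Add `1` to the residue of the ghost modulo `3`. -/
lemma exists_ghost_increment : ∃ s t : Perm (Fin 6), s.IsThreeCycle ∧ t.IsThreeCycle ∧
    ∀ i, s (t i) = splitGhost.symm ((splitGhost i).1, (splitGhost i).2 + 1) :=
  ⟨swap 0 2 * swap 0 1, swap 3 5 * swap 3 4,
    Perm.isThreeCycle_swap_mul_swap_same (by decide) (by decide) (by decide),
    Perm.isThreeCycle_swap_mul_swap_same (by decide) (by decide) (by decide), by decide⟩

lemma wordVal3_congr {n : ℕ} {u v : ℕ → Letter} (h : ∀ t < n, u t = v t) :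
    wordVal3 n u = wordVal3 n v :=
  Finset.sum_congr rfl fun t ht => by rw [h t (Finset.mem_range.1 ht)]

/-- The `n` cells to the right of the head do not contain the head cell if `n < ℓ`. -/
lemma wordVal3_word_update (n : ℕ) (hn : n < ℓ) (p : ZMod ℓ) (u : ZMod ℓ → Letter) (a : Letter) :
    wordVal3 n (word (p + 1, Function.update u p a)) = wordVal3 n (word (p + 1, u)) := by
  refine wordVal3_congr fun t ht => Function.update_of_ne ?_ _ _
  rw [add_assoc, Ne, add_eq_left]
  intro h
  have h' : ((1 + t : ℕ) : ZMod ℓ) = 0 := by exact_mod_cast h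
  rw [ZMod.natCast_eq_zero_iff] at h'
  exact absurd (Nat.le_of_dvd (by omega) h') (by omega)

open Classical in
lemma exists_addCarry (n : ℕ) (hn : n < ℓ) (k : ℕ → Letter) :
    ∃ π : Perm (HConf ℓ), HasLength (gens ℓ) (4736 * n ^ 2 + 387) π ∧
      ∀ x, π x = ((x.1.1, Function.update x.1.2 x.1.1 (x.1.2 x.1.1 + k 0 +
        if Carry n (fun t => k (1 + t)) (x.1.1 + 1, x.1.2) then 1 else 0)), x.2) := by
  obtain ⟨s, t, hs, ht, hst⟩ := exists_ghost_increment
  have hC := (controllable_carry (ℓ := ℓ) n fun t => k (1 + t)).shift 1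
  have hE := hasLength_headGate (ℓ := ℓ) exchange
  have hA := hasLength_headGate (ℓ := ℓ) (prodCongrRight fun _ => Equiv.addRight (k 0))
  refine ⟨_, (((hE.mul ((hC s hs).mul (hC t ht))).mul hE).mul hA).mono (by omega), fun x => ?_⟩
  have hP : ∀ a, Carry n (fun t => k (1 + t)) (x.1.1 + 1, Function.update x.1.2 x.1.1 a) ↔
      Carry n (fun t => k (1 + t)) (x.1.1 + 1, x.1.2) := fun a => by
    rw [Carry, Carry, wordVal3_word_update n hn]
  rw [← ctrl_mul, ← map_mul]
  obtain ⟨⟨p, u⟩, q⟩ := x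
  simp only at hP
  by_cases h : Carry n (fun t => k (1 + t)) (p + 1, u) <;>
    simp [headGate, exchange, ctrl, hP, h, hst]

lemma digit3L_add_mul (n a m t : ℕ) (ht : t < n) :
    digit3L n (3 ^ n * a + m) t = digit3L n m t := by
  ext
  have : 3 ^ n * a = 3 ^ (n - 1 - t) * (3 * (3 ^ t * a)) := by
    rw [show 3 ^ n = 3 ^ (n - 1 - t) * 3 * 3 ^ t by
      rw [← pow_succ, ← pow_add]; congr 1; omega]
    ring
  simp only [digit3L]
  rw [this, Nat.mul_add_div (by positivity), Nat.mul_add_mod]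

lemma digit3L_mod (n m t : ℕ) (ht : t < n) : digit3L n (m % 3 ^ n) t = digit3L n m t := by
  conv_rhs => rw [← Nat.div_add_mod m (3 ^ n), digit3L_add_mul _ _ _ _ ht]

lemma digit3L_succ (n m t : ℕ) : digit3L (n + 1) m (t + 1) = digit3L n m t := by
  rw [digit3L, digit3L, Fin.mk.injEq, show n + 1 - 1 - (t + 1) = n - 1 - t by omega]

lemma digit3L_zero (n : ℕ) (a b : Letter) (v w : ℕ) (hv : v < 3 ^ n) (hw : w < 3 ^ n) :
    digit3L (n + 1) (3 ^ n * a.val + v + (3 ^ n * b.val + w)) 0 =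
      a + b + if 3 ^ n ≤ v + w then 1 else 0 := by
  have hdiv : (3 ^ n * a.val + v + (3 ^ n * b.val + w)) / 3 ^ n =
      a.val + b.val + if 3 ^ n ≤ v + w then 1 else 0 := by
    rw [show 3 ^ n * a.val + v + (3 ^ n * b.val + w) = 3 ^ n * (a.val + b.val) + (v + w) by ring,
      Nat.mul_add_div (by positivity)]
    congr 1
    split_ifs with h
    · exact Nat.div_eq_of_lt_le (by omega) (by omega)
    · exact Nat.div_eq_of_lt (by omega)
  ext
  simp only [digit3L, Nat.add_sub_cancel, Nat.sub_zero, hdiv]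
  split_ifs <;> simp [Fin.val_add]

/-- The addition gate on configurations with a head. -/
lemma exists_add (n : ℕ) (hn : n ≤ ℓ) (k : ℕ → Letter) :
    ∃ π : Perm (HConf ℓ), HasLength (gens ℓ) (5000 * n ^ 3) π ∧
      ∀ x, π x = ((x.1.1, fun j => if (j - x.1.1).val < n then
        digit3L n (wordVal3 n (word x.1) + wordVal3 n k) (j - x.1.1).val else x.1.2 j), x.2) := by
  induction n generalizing k with
  | zero => exact ⟨1, .one, fun x => by simp⟩
  | succ n ih =>
    obtain ⟨α, hα, hα'⟩ := exists_addCarry n hn k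
    obtain ⟨β, hβ, hβ'⟩ := ih (by omega) fun t => k (1 + t)
    have hS := hasLength_shift (ℓ := ℓ) 1
    refine ⟨_, (((hS.inv.mul hβ).mul hS).mul hα).mono (by nlinarith), fun x => ?_⟩
    obtain ⟨⟨p, u⟩, q⟩ := x
    have : NeZero ℓ := ⟨by omega⟩
    simp only [Perm.mul_apply, Perm.inv_eq_iff_eq, hα', hβ', shift, coe_fn_mk, Nat.cast_one,
      wordVal3_word_update n hn]
    simp only [Prod.mk.injEq, and_true, true_and]
    ext1 j
    rw [add_comm n 1, wordVal3_add 1 n, wordVal3_add 1 n k, wordVal3_one, wordVal3_one,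
      add_comm 1 n, word_shift, Nat.cast_one]
    by_cases hj : j = p
    · subst hj
      have hval : ¬ (j - (j + 1)).val < n := by
        obtain ⟨m, rfl⟩ := Nat.exists_eq_succ_of_ne_zero this.out
        rw [sub_add_cancel_left, ZMod.val_neg_one]
        omega
      rw [if_neg hval, sub_self, ZMod.val_zero, if_pos n.succ_pos,
        digit3L_zero _ _ _ _ _ (wordVal3_lt _ _) (wordVal3_lt _ _)]
      simp only [Function.update_self, Carry, word, Nat.cast_zero, add_zero]
      congr
    · have hval : (j - p).val = (j - (p + 1)).val + 1 := by
        have h0 : (j - p).val ≠ 0 := by rwa [Ne, ZMod.val_eq_zero, sub_eq_zero]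
        have hlt := ZMod.val_lt (j - p)
        have hcast : j - (p + 1) = (((j - p).val - 1 : ℕ) : ZMod ℓ) := by
          rw [Nat.cast_sub (by omega), ZMod.natCast_zmod_val, Nat.cast_one]
          ring
        rw [hcast, ZMod.val_natCast_of_lt (by omega)]
        omega
      rw [hval, digit3L_succ, Function.update_of_ne hj]
      simp only [Nat.add_lt_add_iff_right]
      split_ifs with h
      · rw [show ∀ A B C D : ℕ, 3 ^ n * A + B + (3 ^ n * C + D) = 3 ^ n * (A + C) + (B + D) by
          intros; ring, digit3L_add_mul _ _ _ _ h]
      · rfl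

/-! ### Transfer to cyclic configurations -/

/-- The cyclic configuration with given head position, tape and state. -/
def encode (x : HConf ℓ) : CConf DQ Letter ℓ :=
  ⟨fun j => if j = x.1.1 then Sum.inr (x.2, x.1.2 j) else Sum.inl (x.1.2 j), by
    have key : ∀ i, (if i = x.1.1 then Sum.inr (x.2, x.1.2 i) else Sum.inl (x.1.2 i) :
        TSym DQ Letter).isRight = true → i = x.1.1 := by
      intro i
      split_ifs with h <;> simp [h]
    exact fun i j hi hj => (key i hi).trans (key j hj).symm⟩

lemma encode_val (x : HConf ℓ) (j : ZMod ℓ) : (encode x).1 j =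
    if j = x.1.1 then Sum.inr (x.2, x.1.2 j) else Sum.inl (x.1.2 j) := rfl

lemma encode_eq_inr_iff (x : HConf ℓ) (i : ZMod ℓ) (q : DQ) (a : Letter) :
    (encode x).1 i = Sum.inr (q, a) ↔ i = x.1.1 ∧ x.2 = q ∧ x.1.2 i = a := by
  rw [encode_val]
  split_ifs with h <;> simp [h]

lemma tapeLetter_encode (x : HConf ℓ) (j : ZMod ℓ) : tapeLetter ((encode x).1 j) = x.1.2 j := by
  rw [encode_val]
  split_ifs <;> rfl

lemma encode_injective : Function.Injective (encode (ℓ := ℓ)) := by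
  intro x y h
  have h1 := (encode_eq_inr_iff y x.1.1 x.2 (x.1.2 x.1.1)).1
    (h ▸ (encode_eq_inr_iff x _ _ _).2 ⟨rfl, rfl, rfl⟩)
  have h2 : x.1.2 = y.1.2 := funext fun j => by
    rw [← tapeLetter_encode x j, h, tapeLetter_encode]
  exact Prod.ext (Prod.ext h1.1 h2) h1.2.1.symm

lemma encode_of_head (w : CConf DQ Letter ℓ) (i : ZMod ℓ) (q : DQ) (a : Letter)
    (h : w.1 i = Sum.inr (q, a)) : encode ((i, fun j => tapeLetter (w.1 j)), q) = w := by
  refine Subtype.ext (funext fun j => ?_)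
  rw [encode_val]
  split_ifs with hj
  · subst hj
    simp [h, tapeLetter]
  · rcases hw : w.1 j with b | b
    · simp [hw, tapeLetter]
    · exact absurd (w.2 j i (by simp [hw]) (by simp [h])) hj

lemma isLeft_of_notMem_range (w : CConf DQ Letter ℓ) (h : w ∉ Set.range (encode (ℓ := ℓ)))
    (i : ZMod ℓ) : ∃ a, w.1 i = Sum.inl a := by
  rcases hw : w.1 i with a | ⟨q, a⟩
  · exact ⟨a, rfl⟩
  · exact absurd ⟨_, encode_of_head w i q a hw⟩ h

/-- Permutations of configurations with a head, extended to all cyclic configurations. -/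
noncomputable def extend : Perm (HConf ℓ) →* Perm (CConf DQ Letter ℓ) :=
  Perm.viaEmbeddingHom ⟨encode, encode_injective⟩

lemma extend_encode (π : Perm (HConf ℓ)) (x : HConf ℓ) :
    extend π (encode x) = encode (π x) :=
  Perm.viaEmbedding_apply π ⟨encode, encode_injective⟩ x

lemma extend_of_notMem (π : Perm (HConf ℓ)) (w : CConf DQ Letter ℓ)
    (h : w ∉ Set.range (encode (ℓ := ℓ))) : extend π w = w :=
  Perm.viaEmbedding_apply_of_notMem π ⟨encode, encode_injective⟩ w h

lemma extend_mem (π : Perm (HConf ℓ)) (hπ : π ∈ gens ℓ) : extend π ∈ TMGens DQ Letter ℓ := by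
  rcases hπ with ⟨g, rfl⟩ | ⟨q, rfl⟩
  · refine .inl ⟨g, fun w i => ?_⟩
    by_cases hw : w ∈ Set.range (encode (ℓ := ℓ))
    · obtain ⟨x, rfl⟩ := hw
      rw [extend_encode, encode_val, encode_val]
      by_cases hi : i = x.1.1
      · subst hi
        simp [headGate, gateApply]
      · simp [headGate, gateApply, hi]
    · rw [extend_of_notMem _ _ hw]
      obtain ⟨a, ha⟩ := isLeft_of_notMem_range w hw i
      rw [ha, gateApply]
  · refine .inr ⟨q, fun w => ?_⟩
    by_cases hw : w ∈ Set.range (encode (ℓ := ℓ))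
    · obtain ⟨x, rfl⟩ := hw
      rw [extend_encode]
      refine ⟨fun h => ?_, fun i a h j => ?_⟩
      · have hq : x.2 ≠ q := fun hq =>
          h x.1.1 (x.1.2 x.1.1) ((encode_eq_inr_iff x _ _ _).2 ⟨rfl, hq, rfl⟩)
        simp [stateMove, hq]
      · obtain ⟨rfl, rfl, rfl⟩ := (encode_eq_inr_iff x _ _ _).1 h
        rw [tapeLetter_encode, encode_val, encode_val]
        simp only [stateMove, coe_fn_mk, if_true]
        split_ifs with h1 h2 <;> simp_all
    · rw [extend_of_notMem _ _ hw]
      refine ⟨fun _ => rfl, fun i a h => ?_⟩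
      obtain ⟨b, hb⟩ := isLeft_of_notMem_range w hw i
      simp [hb] at h

end TernaryAdd

/-- **Lemma.** There is a constant `K > 0` such that for every `ℓ ≥ 2` and every word
`k ∈ {0,1,2}^*` with `1 ≤ |k| ≤ ℓ`, the permutation `add_k` of `C_ℓ` — which adds
`v₃(k)` modulo `3^{|k|}` to the counter formed by the `|k|` tape letters read rightwards
from the head, fixing everything else — belongs to `G_ℓ` with word norm at most
`K·|k|³`. -/
theorem ternary_addition_gate :
    ∃ K : ℝ, 0 < K ∧ ∀ ℓ : ℕ, 2 ≤ ℓ → ∀ L : ℕ, 1 ≤ L → L ≤ ℓ → ∀ k : ℕ → Letter,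
      ∃ π : Equiv.Perm (CConf DQ Letter ℓ),
        π ∈ Subgroup.closure (TMGens DQ Letter ℓ) ∧
        (∀ w : CConf DQ Letter ℓ,
          ((∀ i : ZMod ℓ, (w.1 i).isLeft = true) → π w = w) ∧
          (∀ (i₀ : ZMod ℓ) (q : DQ) (a : Letter), w.1 i₀ = Sum.inr (q, a) →
            (π w).1 = fun j =>
              if (j - i₀).val < L then
                (if j = i₀ then
                  Sum.inr (q, digit3L L
                    ((wordVal3 L (readWord ℓ w.1 i₀) + wordVal3 L k) % 3 ^ L) (j - i₀).val)
                 else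
                  Sum.inl (digit3L L
                    ((wordVal3 L (readWord ℓ w.1 i₀) + wordVal3 L k) % 3 ^ L) (j - i₀).val))
              else w.1 j)) ∧
        (wordNorm (TMGens DQ Letter ℓ) π : ℝ) ≤ K * (L : ℝ) ^ 3 := by
  refine ⟨5000, by norm_num, fun ℓ hℓ L hL hLℓ k => ?_⟩
  obtain ⟨π, hπ, hspec⟩ := TernaryAdd.exists_add L hLℓ k
  have hlen := hπ.map TernaryAdd.extend TernaryAdd.extend_mem
  refine ⟨TernaryAdd.extend π, hlen.mem_closure, fun w => ⟨fun h => ?_, fun i₀ q a h => ?_⟩, ?_⟩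
  · refine TernaryAdd.extend_of_notMem π w ?_
    rintro ⟨x, rfl⟩
    simpa [TernaryAdd.encode_val] using h x.1.1
  · have hw := TernaryAdd.encode_of_head w i₀ q a h
    ext1 j
    conv_lhs => rw [← hw, TernaryAdd.extend_encode, hspec, TernaryAdd.encode_val]
    have hread : readWord ℓ w.1 i₀ = TernaryAdd.word (i₀, fun j => tapeLetter (w.1 j)) := rfl
    rw [hread]
    by_cases hj : (j - i₀).val < L
    · simp only [hj, if_true, TernaryAdd.digit3L_mod _ _ _ hj]
    · simp only [hj, if_false]
      conv_rhs => rw [← hw, TernaryAdd.encode_val]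
  · exact_mod_cast hlen.wordNorm_le
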